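/- arXiv:1501.01135 — 3 statements merged into one kernel-verified Lean document; each statement's English description precedes it below -/
import Mathlib

section
/- Let k and r be positive integers with r < k and let p = (p_1,…,p_k) be a tuple of non-negative integers with S_{p,r} non-empty. Then Pdet(M_α) = (|M_{p,r}| / |S_{p,r}|) · (1 − p_k/r), where M_α = (M_{α,i,j})_{i,j∈[k]} is the matrix of events with M_{α,i,j} = I^{f(i)}_{i,j} for i∈[k−1] and M_{α,k,j} = Ω for all j∈[k]. -/
open Finset

/-- The cyclic interval `]i,j]` of `[k] = {1,…,k}`, realized inside `ZMod k`
(the element `k` of `[k]` is represented by `0 : ZMod k`). -/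
def cyc (k : ℕ) [NeZero k] (i j : ZMod k) : Finset (ZMod k) :=
  Finset.univ.filter fun x => 1 ≤ (x - i).val ∧ (x - i).val ≤ (j - i).val

/-- Membership in `𝒮_{p,r}` : each `j ∈ [k]` belongs to exactly `p j` of the sets `S_1,…,S_r`. -/
def SprMem (k r : ℕ) [NeZero k] (p : ZMod k → ℕ) (S : Fin r → Finset (ZMod k)) : Prop :=
  ∀ j : ZMod k, Nat.card {i : Fin r // j ∈ S i} = p j

/-- Membership in `ℳ_{p,r}` : member of `𝒮_{p,r}` all of whose sets are proper subsets of `[k]`. -/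
def MprMem (k r : ℕ) [NeZero k] (p : ZMod k → ℕ) (S : Fin r → Finset (ZMod k)) : Prop :=
  SprMem k r p S ∧ ∀ i, S i ≠ Finset.univ

/-- `|ℳ_{p,r}|`. -/
noncomputable def Mcard (k r : ℕ) [NeZero k] (p : ZMod k → ℕ) : ℕ :=
  Nat.card {S : Fin r → Finset (ZMod k) // MprMem k r p S}

/-- `|𝒮_{p,r}|`. -/
noncomputable def Scard (k r : ℕ) [NeZero k] (p : ZMod k → ℕ) : ℕ :=
  Nat.card {S : Fin r → Finset (ZMod k) // SprMem k r p S}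

/-- `|ℳ_{q,r}|` for an integer-valued tuple `q` (empty if some entry of `q` is negative). -/
noncomputable def McardZ (k r : ℕ) [NeZero k] (q : ZMod k → ℤ) : ℕ :=
  Nat.card {S : Fin r → Finset (ZMod k) //
    (∀ j : ZMod k, (Nat.card {i : Fin r // j ∈ S i} : ℤ) = q j) ∧ ∀ i, S i ≠ Finset.univ}

/-- `alphaRel k S i j` holds iff `j = α(i,S)`. -/
def alphaRel (k : ℕ) [NeZero k] (S : Finset (ZMod k)) (i j : ZMod k) : Prop :=
  if S = Finset.univ then j = i else j ∉ S ∧ cyc k i (j - 1) ⊆ S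

/-- `betaRel k S i j` holds iff `j = β(i,S)`. -/
def betaRel (k : ℕ) [NeZero k] (S : Finset (ZMod k)) (i j : ZMod k) : Prop :=
  if S = Finset.univ then j = i else j + 1 ∉ S ∧ cyc k i j ⊆ S

/-- `gammaRel k S i j` holds iff `j = γ(i,S)`. -/
def gammaRel (k : ℕ) [NeZero k] (S : Finset (ZMod k)) (i j : ZMod k) : Prop :=
  if S = Finset.univ then j = i
  else if i ∈ S then j = i - 1
  else j + 1 ∉ S ∧ cyc k i j ⊆ S

/-- The digraph on `[k]` with the `k-1` arcs `(i, ζ(i, S_{f i}))` for `i ∈ [k-1]`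
(the nonzero elements of `ZMod k`) is a tree, i.e. a spanning tree oriented toward
the root `k` (represented by `0`): following the arcs from any vertex reaches the root. -/
def GIsTree (k r : ℕ) [NeZero k] (zeta : Finset (ZMod k) → ZMod k → ZMod k → Prop)
    (S : Fin r → Finset (ZMod k)) (f : {i : ZMod k // i ≠ 0} → Fin r) : Prop :=
  ∃ g : ZMod k → ZMod k, g 0 = 0 ∧
    (∀ i : {i : ZMod k // i ≠ 0}, zeta (S (f i)) i.1 (g i.1)) ∧
    ∀ x : ZMod k, ∃ n : ℕ, g^[n] x = 0

/-- Sample space: pairs of a tuple `S ∈ ℳ_{p,r}` and a surjection `f : [k-1] → [r]`,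
with the uniform probability measure. -/
abbrev OmM (k r : ℕ) [NeZero k] (p : ZMod k → ℕ) : Type :=
  {om : (Fin r → Finset (ZMod k)) × ({i : ZMod k // i ≠ 0} → Fin r) //
    MprMem k r p om.1 ∧ Function.Surjective om.2}

/-- Sample space `Ω`: pairs of a tuple `S ∈ 𝒮_{p,r}` and a surjection `f : [k-1] → [r]`,
with the uniform probability measure. -/
abbrev OmS (k r : ℕ) [NeZero k] (p : ZMod k → ℕ) : Type :=
  {om : (Fin r → Finset (ZMod k)) × ({i : ZMod k // i ≠ 0} → Fin r) //
    SprMem k r p om.1 ∧ Function.Surjective om.2}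

/-- Uniform probability of an event `A` in a (finite) sample space `Om`. -/
noncomputable def PrU {Om : Type} (A : Set Om) : ℚ :=
  (Nat.card A : ℚ) / (Nat.card Om : ℚ)

/-- The `Pr`-determinant of a `k × k` matrix of events (rows and columns indexed by
`[k]`, i.e. by `ZMod k`). -/
noncomputable def Pdet {k : ℕ} [NeZero k] {Om : Type} (E : ZMod k → ZMod k → Set Om) : ℚ :=
  ∑ pi : Equiv.Perm (ZMod k), ((Equiv.Perm.sign pi : ℤ) : ℚ) * PrU (⋂ i : ZMod k, E i (pi i))

/-- The matrix of events `M_α`: `M_{α,i,j} = I^{f(i)}_{i,j}` for `i ∈ [k-1]`, and the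
row of `i = k` (i.e. `0`) is constant equal to `Ω`. -/
def Malpha (k r : ℕ) [NeZero k] (p : ZMod k → ℕ) (i j : ZMod k) : Set (OmS k r p) :=
  {om : OmS k r p | ∀ hi : i ≠ 0, cyc k i j ⊆ om.1.1 (om.1.2 ⟨i, hi⟩)}

/-- The matrix of events `M_β`: `M_{β,i,j} = J^{f(i)}_{i,j+1}` for `i ∈ [k-1]`, and the
row of `i = k` (i.e. `0`) is constant equal to `Ω`. -/
def Mbeta (k r : ℕ) [NeZero k] (p : ZMod k → ℕ) (i j : ZMod k) : Set (OmS k r p) :=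
  {om : OmS k r p | ∀ hi : i ≠ 0,
    if i = j + 1 then om.1.1 (om.1.2 ⟨i, hi⟩) = Finset.univ
    else cyc k i (j + 1) ⊆ om.1.1 (om.1.2 ⟨i, hi⟩)}

/-- Membership of `om` in the event `J^{f(i)}_{a,b}`. -/
def Jmem (k r : ℕ) [NeZero k] (p : ZMod k → ℕ) (om : OmS k r p)
    (i : {i : ZMod k // i ≠ 0}) (a b : ZMod k) : Prop :=
  if a = b then om.1.1 (om.1.2 i) = Finset.univ else cyc k a b ⊆ om.1.1 (om.1.2 i)

/-- The matrix `1 - A`, where `A` is the adjacency matrix of the digraph with an arc from `v` to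
`w` whenever `g v = some w`. -/
def oneSubAdj {V : Type*} [DecidableEq V] (R : Type*) [CommRing R] (g : V → Option V) :
    Matrix V V R :=
  Matrix.of fun v w => (if v = w then 1 else 0) - (if g v = some w then 1 else 0)

theorem det_oneSubAdj_of_wellFounded {V R : Type*} [Fintype V] [DecidableEq V] [CommRing R]
    {g : V → Option V} (h : WellFounded fun w v => g v = some w) :
    (oneSubAdj R g).det = 1 := by
  have : IsWellFounded V fun w v => g v = some w := ⟨h⟩
  let rk : V → Ordinal := IsWellFounded.rank fun w v => g v = some w
  have hlt : ∀ v w, g v = some w → rk w < rk v := fun v w hvw =>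
    IsWellFounded.rank_lt_of_rel hvw
  have hT : (oneSubAdj R g).BlockTriangular (fun v => OrderDual.toDual (rk v)) := by
    intro v w hvw
    have hvw' : rk v < rk w := hvw
    have h1 : v ≠ w := by rintro rfl; exact lt_irrefl _ hvw'
    have h2 : g v ≠ some w := fun e => lt_asymm hvw' (hlt v w e)
    simp [oneSubAdj, h1, h2]
  rw [hT.det]
  refine Finset.prod_eq_one fun a _ => ?_
  have : (oneSubAdj R g).toSquareBlock (fun v => OrderDual.toDual (rk v)) a = 1 := by
    ext ⟨v, hv⟩ ⟨w, hw⟩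
    have h2 : g v ≠ some w := fun e => by
      have := hlt v w e
      have e' : rk v = rk w := OrderDual.toDual.injective (hv.trans hw.symm)
      exact absurd this (by simp [e'])
    simp [oneSubAdj, Matrix.toSquareBlock_def, h2, Matrix.one_apply]
  rw [this, Matrix.det_one]

theorem det_oneSubAdj_of_not_wellFounded {V R : Type*} [Fintype V] [DecidableEq V] [CommRing R]
    [IsDomain R] {g : V → Option V} (h : ¬ WellFounded fun w v => g v = some w) :
    (oneSubAdj R g).det = 0 := by
  classical
  rw [← Matrix.exists_mulVec_eq_zero_iff]
  let u : V → R := fun v => if Acc (fun w v => g v = some w) v then 0 else 1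
  refine ⟨u, ?_, ?_⟩
  · intro h0
    refine h ⟨fun v => ?_⟩
    by_contra hv
    simpa [u, hv] using congrFun h0 v
  · funext v
    have key : Acc (fun w v => g v = some w) v ↔
        ∀ w, g v = some w → Acc (fun w v => g v = some w) w :=
      ⟨fun hv w hw => hv.inv hw, fun hv => ⟨v, hv⟩⟩
    rcases hg : g v with _ | w
    · have hv : Acc (fun w v => g v = some w) v := key.2 (by simp [hg])
      have hu : u v = 0 := if_pos hv
      simp [Matrix.mulVec, dotProduct, oneSubAdj, hg, hu]
    · have hv : Acc (fun w v => g v = some w) v ↔ Acc (fun w v => g v = some w) w := by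
        rw [key]; simp [hg]
      have hu : u v = u w := by simp only [u, hv]
      simp [Matrix.mulVec, dotProduct, oneSubAdj, hg, sub_mul, Finset.sum_sub_distrib, hu]

/-- The determinant of a cyclic bidiagonal matrix. -/
theorem det_cyclic_bidiagonal {R : Type*} [CommRing R] {k : ℕ} [NeZero k] (hk : 1 < k)
    (a b : ZMod k → R) :
    (Matrix.of fun i j : ZMod k =>
      (if i = j then a i else 0) - (if j = i + 1 then b i else 0)).det =
      ∏ i, a i - ∏ i, b i := by
  obtain ⟨n, rfl⟩ : ∃ n, k = n + 1 := ⟨k - 1, by omega⟩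
  have : Fact (1 < n + 1) := ⟨hk⟩
  have hne : ∀ i : ZMod (n + 1), i ≠ i + 1 := fun i => by simp
  let s : Equiv.Perm (ZMod (n + 1)) := Equiv.addRight 1
  have hs : Equiv.Perm.sign s = (-1) ^ n := by
    have : s = (finRotate (n + 1) : Equiv.Perm (ZMod (n + 1))) := by
      ext i : 1
      exact (finRotate_apply (n := n + 1) i).symm
    rw [this]
    exact sign_finRotate (n + 1)
  have hs1 : s ≠ 1 := fun h => hne 0 (congrArg (fun e : Equiv.Perm (ZMod (n + 1)) => e 0) h).symm
  have hcard : Fintype.card (ZMod (n + 1)) = n + 1 := ZMod.card _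
  rw [Matrix.det_apply', ← Finset.sum_subset (Finset.subset_univ {1, s⁻¹}),
    Finset.sum_pair (by simpa [eq_comm] using hs1)]
  · have e1 : ∀ i : ZMod (n + 1), (if s⁻¹ i = i then a (s⁻¹ i) else 0) = 0 := fun i => by
      rw [if_neg]
      intro h
      have : s i = i := by conv_lhs => rw [← h]; simp
      exact hne i this.symm
    have e2 : ∀ i : ZMod (n + 1), (if i = s⁻¹ i + 1 then b (s⁻¹ i) else 0) = b (s⁻¹ i) :=
      fun i => by
        rw [if_pos]
        exact (s.apply_symm_apply i).symm
    have e3 : ∏ i, b (s⁻¹ i) = ∏ i, b i := Equiv.prod_comp s⁻¹ b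
    simp only [Matrix.of_apply, e1, e2, zero_sub, Finset.prod_neg, e3]
    simp [hne, hs, Finset.card_univ, hcard, pow_succ, ← mul_assoc, ← mul_pow]
    ring
  · intro σ _ hσ
    by_contra hne0
    have hz : ∀ i, σ i = i ∨ i = σ i + 1 := by
      intro i
      by_contra hcon
      push Not at hcon
      refine hne0 ?_
      rw [Finset.prod_eq_zero (Finset.mem_univ i), mul_zero]
      simp [hcon.1, hcon.2]
    refine hσ ?_
    by_cases h1 : ∀ i, σ i = i
    · have : σ = 1 := Equiv.ext h1
      simp [this]
    · push Not at h1
      obtain ⟨i₀, hi₀⟩ := h1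
      have step : ∀ i, i = σ i + 1 → i - 1 = σ (i - 1) + 1 := by
        intro i hi
        rcases hz (i - 1) with h | h
        · have : σ (i - 1) = σ i := by rw [h]; exact sub_eq_of_eq_add hi
          have := σ.injective this
          exact absurd this (by simp)
        · exact h
      have all : ∀ m : ℕ, i₀ - m = σ (i₀ - m) + 1 := by
        intro m
        induction m with
        | zero => simpa using (hz i₀).resolve_left hi₀
        | succ m ih => have := step _ ih; push_cast; rwa [← sub_sub]
      have : σ = s⁻¹ := by
        rw [eq_inv_iff_mul_eq_one]
        have : s * σ = 1 := by
          ext i : 1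
          have := all (i₀ - i).val
          simp only [ZMod.natCast_val, ZMod.cast_id', id_eq, sub_sub_cancel] at this
          exact this.symm
        rw [mul_eq_one_iff_eq_inv] at this
        rw [this, mul_inv_cancel]
      simp [this]

theorem exists_gap {k : ℕ} [NeZero k] (T : Finset (ZMod k)) (i : ZMod k) :
    ∃ d : ℕ, 1 ≤ d ∧ (i + d ∉ T ∨ d = k) :=
  ⟨k, NeZero.one_le, Or.inr rfl⟩

/-- The distance from `i` to the next element outside `T` in cyclic order (or `k`, if there is
no such element). -/
def gap {k : ℕ} [NeZero k] (T : Finset (ZMod k)) (i : ZMod k) : ℕ :=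
  Nat.find (exists_gap T i)

section gap

variable {k : ℕ} [NeZero k] (T : Finset (ZMod k)) (i : ZMod k)

theorem one_le_gap : 1 ≤ gap T i := (Nat.find_spec (exists_gap T i)).1

theorem gap_le : gap T i ≤ k := Nat.find_min' _ ⟨NeZero.one_le, Or.inr rfl⟩

variable {T i}

theorem add_mem_of_lt_gap {e : ℕ} (he : 1 ≤ e) (h : e < gap T i) : i + e ∈ T := by
  have := Nat.find_min (exists_gap T i) h
  by_contra hc
  exact this ⟨he, Or.inl hc⟩

theorem add_gap_notMem (h : T ≠ Finset.univ) : i + gap T i ∉ T := by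
  rcases (Nat.find_spec (exists_gap T i)).2 with h' | h'
  · exact h'
  · change gap T i = k at h'
    intro hi
    refine h (Finset.eq_univ_of_forall fun x => ?_)
    rcases Nat.eq_zero_or_pos (x - i).val with h0 | h0
    · have : x = i := by rw [ZMod.val_eq_zero] at h0; exact sub_eq_zero.1 h0
      rw [h'] at hi
      simpa [this] using hi
    · have := add_mem_of_lt_gap (T := T) (i := i) h0 ((ZMod.val_lt (x - i)).trans_eq h'.symm)
      simpa using this

theorem gap_univ : gap (Finset.univ : Finset (ZMod k)) i = k := by
  rcases (Nat.find_spec (exists_gap (Finset.univ : Finset (ZMod k)) i)).2 with h | h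
  · exact absurd (Finset.mem_univ _) h
  · exact h

theorem cyc_subset_iff {j : ZMod k} : cyc k i j ⊆ T ↔ (j - i).val < gap T i := by
  constructor
  · intro h
    by_contra! hc
    have hlt : gap T i < k := hc.trans_lt (ZMod.val_lt _)
    have hval : ((gap T i : ℕ) : ZMod k).val = gap T i := ZMod.val_natCast_of_lt hlt
    have hm : i + gap T i ∈ T := h (by
      simp only [cyc, Finset.mem_filter, Finset.mem_univ, true_and, add_sub_cancel_left, hval]
      exact ⟨one_le_gap T i, hc⟩)
    refine add_gap_notMem ?_ hm
    rintro rfl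
    exact hlt.ne gap_univ
  · intro h x hx
    simp only [cyc, Finset.mem_filter, Finset.mem_univ, true_and] at hx
    have := add_mem_of_lt_gap (T := T) (i := i) hx.1 (hx.2.trans_lt h)
    simpa using this

theorem indicator_cyc_sub_indicator_cyc (hk : 1 < k) (j : ZMod k) :
    (if cyc k i j ⊆ T then (1 : ℚ) else 0) - (if cyc k i (j - 1) ⊆ T then 1 else 0) =
      (if i = j then 1 else 0) - (if i + gap T i = j then 1 else 0) := by
  have h1 := one_le_gap T i
  have h2 := gap_le T i
  have hu := ZMod.val_lt (j - i)
  have e0 : i + (gap T i : ZMod k) = j ↔ (gap T i : ZMod k) = j - i := by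
    rw [eq_sub_iff_add_eq, add_comm]
  have e1 : (gap T i : ZMod k) = j - i ↔ gap T i % k = (j - i).val := by
    rw [← ZMod.val_natCast]
    exact ⟨fun h => by rw [h], fun h => ZMod.val_injective k h⟩
  have e2 : i = j ↔ (j - i).val = 0 := by
    rw [ZMod.val_eq_zero, sub_eq_zero, eq_comm]
  have e3 : (j - 1 - i).val = if (j - i).val = 0 then k - 1 else (j - i).val - 1 := by
    have : Fact (1 < k) := ⟨hk⟩
    split_ifs with h
    · rw [← e2] at h
      subst h
      obtain ⟨n, rfl⟩ : ∃ n, k = n + 1 := ⟨k - 1, by omega⟩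
      rw [sub_right_comm, sub_self, zero_sub, ZMod.val_neg_one]
      rfl
    · rw [sub_right_comm, ZMod.val_sub, ZMod.val_one]
      rw [ZMod.val_one]
      omega
  simp only [cyc_subset_iff, e0, e1, e2, e3]
  rcases h2.lt_or_eq with h3 | h3
  · rw [Nat.mod_eq_of_lt h3]
    split_ifs <;> first | omega | norm_num
  · rw [h3, Nat.mod_self]
    split_ifs <;> first | omega | norm_num

end gap

/-- The partial map sending a nonzero `i` to the next element outside `S (f i)`. -/
def nextStep {k r : ℕ} [NeZero k] (f : {i : ZMod k // i ≠ 0} → Fin r)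
    (S : Fin r → Finset (ZMod k)) (i : ZMod k) : Option (ZMod k) :=
  if h : i ≠ 0 then some (i + gap (S (f ⟨i, h⟩)) i) else none

theorem det_indicator_cyc {k r : ℕ} [NeZero k] (hk : 1 < k)
    (f : {i : ZMod k // i ≠ 0} → Fin r) (S : Fin r → Finset (ZMod k)) :
    (Matrix.of fun i j : ZMod k =>
      if ∀ h : i ≠ 0, cyc k i j ⊆ S (f ⟨i, h⟩) then (1 : ℚ) else 0).det =
      (oneSubAdj ℚ (nextStep f S)).det := by
  set A : Matrix (ZMod k) (ZMod k) ℚ := Matrix.of fun i j : ZMod k =>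
      if ∀ h : i ≠ 0, cyc k i j ⊆ S (f ⟨i, h⟩) then (1 : ℚ) else 0 with hA
  let K : Matrix (ZMod k) (ZMod k) ℚ := Matrix.of fun i j : ZMod k =>
      (if i = j then 1 else 0) - (if j = i + 1 then (if i = -1 then 0 else 1) else 0)
  have hK : K.det = 1 := by
    have := Finset.prod_eq_zero (f := fun i : ZMod k => if i = -1 then (0 : ℚ) else 1)
      (Finset.mem_univ (-1)) (if_pos rfl)
    rw [det_cyclic_bidiagonal hk (fun _ => (1 : ℚ)) (fun i => if i = -1 then 0 else 1), this]
    simp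
  have hAK : ∀ i j, (A * K) i j = A i j - (if j = 0 then 0 else A i (j - 1)) := by
    intro i j
    have : ∀ x : ZMod k, (if j = x + 1 then (if x = -1 then (0 : ℚ) else 1) else 0) =
        if x = j - 1 then (if j = 0 then 0 else 1) else 0 := by
      intro x
      have h1 : j = x + 1 ↔ x = j - 1 := by rw [eq_sub_iff_add_eq, eq_comm]
      by_cases h : x = j - 1
      · simp [h]
      · simp [h1, h]
    simp only [Matrix.mul_apply, K, Matrix.of_apply, this, mul_sub, Finset.sum_sub_distrib]
    simp
  rw [← mul_one A.det, ← hK, ← Matrix.det_mul]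
  refine Matrix.det_eq_of_forall_row_eq_smul_add_const
    (fun i => if i = 0 then 0 else (A * K) i 0 - oneSubAdj ℚ (nextStep f S) i 0) 0 (by simp) ?_
  intro i j
  have h0 : ∀ j, oneSubAdj ℚ (nextStep f S) 0 j = if j = 0 then 1 else 0 := by
    intro j
    simp [oneSubAdj, nextStep, eq_comm]
  rw [h0]
  by_cases hi : i = 0
  · subst hi
    rw [h0, hAK]
    by_cases hj : j = 0 <;> simp [hA, hj]
  · by_cases hj : j = 0
    · subst hj; simp [hi]
    · have := indicator_cyc_sub_indicator_cyc (T := S (f ⟨i, hi⟩)) (i := i) hk j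
      rw [hAK]
      simpa [hA, hi, hj, oneSubAdj, nextStep] using this

/-- The partial map on pairs `(j, t)` that scans `j` with current index `t`: if `j ∈ S t` the scan
goes on with index `t`; otherwise the index becomes `f j`, or the scan stops if `j = 0`. -/
def scanStep {k r : ℕ} [NeZero k] (f : {i : ZMod k // i ≠ 0} → Fin r)
    (S : Fin r → Finset (ZMod k)) (v : ZMod k × Fin r) : Option (ZMod k × Fin r) :=
  if v.1 ∈ S v.2 then some (v.1 + 1, v.2)
  else if h : v.1 ≠ 0 then some (v.1 + 1, f ⟨v.1, h⟩) else none

section scan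

variable {k r : ℕ} [NeZero k] {f : {i : ZMod k // i ≠ 0} → Fin r}
  {S : Fin r → Finset (ZMod k)}

theorem scanStep_reflTransGen (t : Fin r) (i : ZMod k) {e : ℕ} (he : e + 1 ≤ gap (S t) i) :
    Relation.ReflTransGen (fun w v => scanStep f S v = some w) (i + (e + 1 : ℕ), t) (i + 1, t) := by
  induction e with
  | zero => simpa using Relation.ReflTransGen.refl
  | succ e ih =>
    refine Relation.ReflTransGen.head ?_ (ih (by omega))
    have : i + ((e + 1 : ℕ) : ZMod k) ∈ S t := add_mem_of_lt_gap (by omega) (by omega)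
    simp only [scanStep, this, if_true]
    push_cast
    simp [add_assoc]

theorem scanStep_reflTransGen_gap (t : Fin r) (i : ZMod k) :
    Relation.ReflTransGen (fun w v => scanStep f S v = some w) (i + gap (S t) i, t) (i + 1, t) := by
  have h := one_le_gap (S t) i
  have := scanStep_reflTransGen (f := f) (S := S) t i (e := gap (S t) i - 1) (by omega)
  rwa [Nat.sub_add_cancel h] at this

theorem scanStep_transGen (i : {i : ZMod k // i ≠ 0}) (h' : i.1 + gap (S (f i)) i.1 ≠ 0) :
    Relation.TransGen (fun w v => scanStep f S v = some w)
      (i.1 + gap (S (f i)) i.1 + 1, f ⟨i.1 + gap (S (f i)) i.1, h'⟩) (i.1 + 1, f i) := by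
  refine Relation.TransGen.head' ?_ (scanStep_reflTransGen_gap (f i) i.1)
  by_cases hu : S (f i) = Finset.univ
  · have hg : i.1 + (gap (S (f i)) i.1 : ZMod k) = i.1 := by rw [hu, gap_univ]; simp
    have : (⟨i.1 + gap (S (f i)) i.1, h'⟩ : {i : ZMod k // i ≠ 0}) = i := Subtype.ext hg
    rw [this]
    simp [scanStep, hu]
  · have := add_gap_notMem (i := i.1) hu
    simp only [scanStep, this, if_false, dif_pos h']

theorem wellFounded_nextStep_of_scanStep
    (h : WellFounded fun w v => scanStep f S v = some w) :
    WellFounded fun w v => nextStep f S v = some w := by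
  have acc0 : Acc (fun w v => nextStep f S v = some w) 0 := ⟨_, by simp [nextStep]⟩
  have key : ∀ v : ZMod k × Fin r, ∀ i : {i : ZMod k // i ≠ 0}, v = (i.1 + 1, f i) →
      Acc (fun w v => nextStep f S v = some w) i.1 := by
    intro v
    induction v using h.transGen.induction with
    | _ v ih =>
      rintro i rfl
      refine ⟨_, fun j hj => ?_⟩
      have hj' : i.1 + gap (S (f i)) i.1 = j := by
        simpa [nextStep, i.2] using hj
      subst hj'
      by_cases h' : i.1 + (gap (S (f i)) i.1 : ZMod k) = 0
      · rw [h']; exact acc0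
      · exact ih _ (scanStep_transGen i h') ⟨_, h'⟩ rfl
  refine ⟨fun i => ?_⟩
  by_cases hi : i = 0
  · rw [hi]; exact acc0
  · exact key _ ⟨i, hi⟩ rfl

theorem acc_scanStep_of_reflTransGen {v w : ZMod k × Fin r}
    (h : Relation.ReflTransGen (fun w v => scanStep f S v = some w) w v)
    (hw : Acc (fun w v => scanStep f S v = some w) w) :
    Acc (fun w v => scanStep f S v = some w) v := by
  induction h with
  | refl => exact hw
  | tail _ hbc ih =>
    refine ⟨_, fun u hu => ?_⟩
    have := Option.some.inj (hu.symm.trans hbc)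
    rwa [this]

theorem wellFounded_scanStep_of_nextStep (hf : Function.Surjective f)
    (h : WellFounded fun w v => nextStep f S v = some w) :
    WellFounded fun w v => scanStep f S v = some w := by
  have hS : ∀ t, S t ≠ Finset.univ := by
    intro t ht
    obtain ⟨i, rfl⟩ := hf t
    have hi : nextStep f S i.1 = some i.1 := by simp [nextStep, i.2, ht, gap_univ]
    exact h.asymmetric _ _ hi hi
  have step : ∀ (i : ZMod k) (t : Fin r), (∀ h' : i + (gap (S t) i : ZMod k) ≠ 0,
      Acc (fun w v => scanStep f S v = some w) (i + gap (S t) i + 1, f ⟨i + gap (S t) i, h'⟩)) →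
      Acc (fun w v => scanStep f S v = some w) (i + 1, t) := by
    intro i t hacc
    refine acc_scanStep_of_reflTransGen (scanStep_reflTransGen_gap t i) ⟨_, fun w hw => ?_⟩
    have hn := add_gap_notMem (i := i) (hS t)
    by_cases h' : i + (gap (S t) i : ZMod k) = 0
    · rw [h'] at hn
      simp [scanStep, h', hn] at hw
    · simp only [scanStep, hn, if_false, dif_pos h', ne_eq] at hw
      rw [← Option.some.inj hw]
      exact hacc h'
  have key : ∀ i : ZMod k, ∀ hi : i ≠ 0,
      Acc (fun w v => scanStep f S v = some w) (i + 1, f ⟨i, hi⟩) := by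
    intro i
    induction i using h.induction with
    | _ i ih =>
      intro hi
      refine step i _ fun h' => ih _ ?_ h'
      simp [nextStep, hi]
  refine ⟨fun v => ?_⟩
  have := step (v.1 - 1) v.2 fun h' => key _ h'
  simpa using this

theorem det_scanStep_eq_C_det_indicator_cyc (hk : 1 < k) (hf : Function.Surjective f)
    {σ : Type*} :
    (oneSubAdj (MvPolynomial σ ℚ) (scanStep f S)).det =
      MvPolynomial.C (Matrix.of fun i j : ZMod k =>
        if ∀ h : i ≠ 0, cyc k i j ⊆ S (f ⟨i, h⟩) then (1 : ℚ) else 0).det := by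
  rw [det_indicator_cyc hk]
  by_cases h : WellFounded fun w v => nextStep f S v = some w
  · rw [det_oneSubAdj_of_wellFounded h,
      det_oneSubAdj_of_wellFounded (wellFounded_scanStep_of_nextStep hf h), map_one]
  · rw [det_oneSubAdj_of_not_wellFounded h, det_oneSubAdj_of_not_wellFounded
      (mt wellFounded_nextStep_of_scanStep h), map_zero]

end scan

/-- The weighted sum of the matrices `oneSubAdj R (scanStep f S)` in which every row is averaged
over its two possible values, with weight `x j` for `j ∈ S t` and weight `1` for `j ∉ S t`. -/
def scanMatrix {k r : ℕ} [NeZero k] {R : Type*} [CommRing R] (f : {i : ZMod k // i ≠ 0} → Fin r)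
    (x : ZMod k → R) : Matrix (ZMod k × Fin r) (ZMod k × Fin r) R :=
  Matrix.of fun v w =>
    (if v.1 = w.1 then if v.2 = w.2 then 1 + x v.1 else 0 else 0) -
    (if w.1 = v.1 + 1 then if w.2 = v.2 then x v.1 else 0 else 0) -
    (if h : v.1 ≠ 0 then if w.1 = v.1 + 1 then if w.2 = f ⟨v.1, h⟩ then 1 else 0 else 0 else 0)

/-- Tuples of subsets of `α` correspond to subsets of `α × ι`. -/
def tupleEquivFinset (α ι : Type*) [Fintype α] [Fintype ι] [DecidableEq α] [DecidableEq ι] :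
    (ι → Finset α) ≃ Finset (α × ι) where
  toFun S := Finset.univ.filter fun v => v.1 ∈ S v.2
  invFun s t := Finset.univ.filter fun j => (j, t) ∈ s
  left_inv S := by ext; simp
  right_inv s := by ext; simp

theorem sum_weight_mul_det_scanStep {k r : ℕ} [NeZero k] {R : Type*} [CommRing R]
    (f : {i : ZMod k // i ≠ 0} → Fin r) (x : ZMod k → R) :
    ∑ S : Fin r → Finset (ZMod k),
      (∏ v : ZMod k × Fin r, if v.1 ∈ S v.2 then x v.1 else 1) *
        (oneSubAdj R (scanStep f S)).det = (scanMatrix f x).det := by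
  let m : Matrix (ZMod k × Fin r) (ZMod k × Fin r) R := Matrix.of fun v w =>
    x v.1 * ((if v = w then 1 else 0) - (if w = (v.1 + 1, v.2) then 1 else 0))
  let m' : Matrix (ZMod k × Fin r) (ZMod k × Fin r) R := Matrix.of fun v w =>
    (if v = w then 1 else 0) -
      (if h : v.1 ≠ 0 then if w = (v.1 + 1, f ⟨v.1, h⟩) then 1 else 0 else 0)
  have hm : scanMatrix f x = m + m' := by
    ext ⟨j, t⟩ ⟨j', t'⟩
    simp only [scanMatrix, m, m', Matrix.of_apply, Matrix.add_apply, Prod.mk.injEq, ite_and,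
      mul_sub, mul_ite, mul_one, mul_zero]
    split_ifs <;> ring
  rw [hm]
  refine Eq.trans ?_ (Matrix.detRowAlternating.map_add_univ m m').symm
  refine Fintype.sum_equiv (tupleEquivFinset (ZMod k) (Fin r)) _ _ fun S => ?_
  rw [← Matrix.det_mul_column]
  refine congrArg Matrix.det ?_
  ext v w
  by_cases hv : v.1 ∈ S v.2
  · have : v ∈ tupleEquivFinset (ZMod k) (Fin r) S := by simp [tupleEquivFinset, hv]
    simp [Finset.piecewise, this, m, hv, oneSubAdj, scanStep, eq_comm]
  · have : v ∉ tupleEquivFinset (ZMod k) (Fin r) S := by simp [tupleEquivFinset, hv]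
    by_cases h0 : v.1 = 0
    · have hv' : (0 : ZMod k) ∉ S v.2 := h0 ▸ hv
      simp [Finset.piecewise, this, m', hv', oneSubAdj, scanStep, h0]
    · simp [Finset.piecewise, this, m', hv, oneSubAdj, scanStep, h0, eq_comm]

open scoped Kronecker in
theorem det_scanMatrix {k n : ℕ} [NeZero k] (hk : 1 < k) {R : Type*} [CommRing R]
    (f : {i : ZMod k // i ≠ 0} → Fin (n + 1)) (x : ZMod k → R) :
    (scanMatrix f x).det =
      (∏ j, (1 + x j) - ∏ j, (x j + if j = 0 then 0 else 1)) *
        (∏ j, (1 + x j) - ∏ j, x j) ^ n := by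
  let U : Matrix (Fin (n + 1)) (Fin (n + 1)) R := Matrix.of fun t t' =>
    if t' = 0 then 1 else if t = t' then 1 else 0
  have hU : U.det = 1 := by
    rw [Matrix.det_of_isLowerTriangular (M := U)]
    · refine Finset.prod_eq_one fun t _ => ?_
      simp [U]
    · intro t t' h
      have h : t < t' := h
      simp [U, h.ne, (Fin.zero_le t).trans_lt h |>.ne']
  let V : Matrix (ZMod k × Fin (n + 1)) (ZMod k × Fin (n + 1)) R := 1 ⊗ₖ U
  have hV : V.det = 1 := by
    simp [V, Matrix.det_kronecker, hU]
  let B : Matrix (ZMod k × Fin (n + 1)) (ZMod k × Fin (n + 1)) R := Matrix.of fun v w =>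
    (if v.1 = w.1 then if v.2 = w.2 then 1 + x v.1 else 0 else 0) -
    (if w.1 = v.1 + 1 then if w.2 = v.2 then x v.1 else 0 else 0) -
    (if h : v.1 ≠ 0 then if w.1 = v.1 + 1 then if v.2 = 0 then U (f ⟨v.1, h⟩) w.2 else 0
      else 0 else 0)
  have hl : ∀ (X : Matrix (ZMod k × Fin (n + 1)) (ZMod k × Fin (n + 1)) R) j t w,
      (V * X) (j, t) w = ∑ u, U t u * X (j, u) w := by
    intro X j t w
    simp [V, Matrix.mul_apply, Fintype.sum_prod_type, Matrix.one_apply]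
  have hr : ∀ (X : Matrix (ZMod k × Fin (n + 1)) (ZMod k × Fin (n + 1)) R) v j t,
      (X * V) v (j, t) = ∑ u, X v (j, u) * U u t := by
    intro X v j t
    simp [V, Matrix.mul_apply, Fintype.sum_prod_type, Matrix.one_apply]
  have hc : scanMatrix f x * V = V * B := by
    ext ⟨j, t⟩ ⟨j', t'⟩
    rw [hl, hr]
    have hU0 : U t 0 = 1 := by simp [U]
    simp only [scanMatrix, B, Matrix.of_apply, sub_mul, mul_sub, Finset.sum_sub_distrib]
    congr 1
    · congr 1
      · split_ifs <;> simp [mul_comm]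
      · split_ifs <;> simp [mul_comm]
    · split_ifs <;> simp [hU0]
  have hdet : (scanMatrix f x).det = B.det := by
    have := congrArg Matrix.det hc
    rwa [Matrix.det_mul, Matrix.det_mul, hV, mul_one, one_mul] at this
  have hB : B.BlockTriangular Prod.snd := by
    intro v w h
    have h1 : v.2 ≠ w.2 := h.ne'
    have h2 : v.2 ≠ 0 := (Fin.zero_le w.2).trans_lt h |>.ne'
    simp [B, h1, h1.symm, h2]
  have hblock : ∀ t, (B.toSquareBlock Prod.snd t).det =
      ∏ j, (1 + x j) - ∏ j, (x j + if j = 0 then 0 else if t = 0 then 1 else 0) := by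
    intro t
    let e : ZMod k ≃ {v : ZMod k × Fin (n + 1) // v.2 = t} :=
      { toFun := fun j => ⟨(j, t), rfl⟩
        invFun := fun v => v.1.1
        left_inv := fun j => rfl
        right_inv := by rintro ⟨⟨j, t'⟩, rfl⟩; rfl }
    rw [← Matrix.det_submatrix_equiv_self e, ← det_cyclic_bidiagonal hk]
    congr 1
    ext i j
    have hUt : t = 0 → ∀ s, U s t = 1 := by rintro rfl s; simp [U]
    by_cases h0 : i = 0 <;> by_cases ht : t = 0 <;> by_cases h2 : j = i + 1 <;>
    simp_all [e, B, Matrix.toSquareBlock_def, sub_sub]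
  rw [hdet, hB.det, Finset.image_univ_of_surjective Prod.snd_surjective,
    Finset.prod_congr rfl fun t _ => hblock t, Fin.prod_univ_succ]
  simp

theorem sum_weight_of_ne_univ {α ι R : Type*} [Fintype α] [Fintype ι] [DecidableEq α]
    [DecidableEq ι] [CommRing R] (x : α → R) :
    ∑ S : ι → Finset α, (if ∀ t, S t ≠ Finset.univ then
      ∏ v : α × ι, (if v.1 ∈ S v.2 then x v.1 else 1) else 0) =
      (∏ j, (1 + x j) - ∏ j, x j) ^ Fintype.card ι := by
  have h : ∏ j, (1 + x j) - ∏ j, x j =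
      ∑ T : Finset α, if T ≠ Finset.univ then ∏ j ∈ T, x j else 0 := by
    rw [Finset.prod_one_add, Finset.powerset_univ, sub_eq_iff_eq_add,
      ← Finset.add_sum_erase _ _ (Finset.mem_univ (Finset.univ : Finset α)),
      ← Finset.sum_filter, add_comm]
    congr 2
    ext; simp
  rw [h, ← Finset.card_univ, ← Finset.prod_const, Finset.prod_univ_sum, Fintype.piFinset_univ]
  refine Finset.sum_congr rfl fun S _ => ?_
  rw [Finset.prod_ite_zero, Fintype.prod_prod_type_right]
  simp [Finset.prod_ite_mem]

section coefficients

open MvPolynomial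

variable {k r : ℕ} [NeZero k]

theorem coeff_prod_X (p : ZMod k → ℕ) (S : Fin r → Finset (ZMod k)) (c : ℚ) :
    coeff (Finsupp.equivFunOnFinite.symm p)
      ((∏ v : ZMod k × Fin r, if v.1 ∈ S v.2 then X v.1 else 1) * C c) =
      open Classical in if SprMem k r p S then c else 0 := by
  classical
  have h : (∏ v : ZMod k × Fin r, if v.1 ∈ S v.2 then (X v.1 : MvPolynomial (ZMod k) ℚ) else 1) =
      monomial (Finsupp.equivFunOnFinite.symm fun j => Nat.card {t : Fin r // j ∈ S t}) 1 := by
    rw [monomial_eq, Fintype.prod_prod_type, Finsupp.prod_fintype _ _ (by simp)]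
    simp [Finset.prod_ite, Fintype.card_subtype]
  rw [h, mul_comm, coeff_C_mul, coeff_monomial, mul_ite, mul_one, mul_zero]
  refine if_congr ?_ rfl rfl
  rw [Finsupp.equivFunOnFinite.symm.injective.eq_iff, funext_iff]
  rfl

theorem sum_det_mul (hk : 1 < k) (hr : 0 < r) {f : {i : ZMod k // i ≠ 0} → Fin r}
    (hf : Function.Surjective f) (p : ZMod k → ℕ) :
    (r : ℚ) * (∑ S : Fin r → Finset (ZMod k), open Classical in if SprMem k r p S then
      (Matrix.of fun i j : ZMod k =>
        if ∀ h : i ≠ 0, cyc k i j ⊆ S (f ⟨i, h⟩) then (1 : ℚ) else 0).det else 0) =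
      (r - p 0) * Mcard k r p := by
  classical
  obtain ⟨n, rfl⟩ : ∃ n, r = n + 1 := ⟨r - 1, by omega⟩
  let q : ZMod k →₀ ℕ := Finsupp.equivFunOnFinite.symm p
  let W : MvPolynomial (ZMod k) ℚ := ∏ j, (1 + X j) - ∏ j, X j
  let Y : MvPolynomial (ZMod k) ℚ := ∏ j ∈ Finset.univ.erase 0, (1 + X j)
  let Z : MvPolynomial (ZMod k) ℚ := ∏ j ∈ Finset.univ.erase 0, X j
  have hW : W = (1 + X 0) * Y - X 0 * Z := by
    simp only [W, Y, Z]
    rw [Finset.mul_prod_erase _ (fun j => 1 + X j) (Finset.mem_univ 0),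
      Finset.mul_prod_erase _ (fun j => X j) (Finset.mem_univ 0)]
  have hG : (scanMatrix f (X : ZMod k → MvPolynomial (ZMod k) ℚ)).det = Y * W ^ n := by
    have h1 : ∏ j, (X j + if j = 0 then (0 : MvPolynomial (ZMod k) ℚ) else 1) = X 0 * Y := by
      rw [← Finset.mul_prod_erase _ _ (Finset.mem_univ 0)]
      simp only [if_true, add_zero, Y]
      congr 1
      refine Finset.prod_congr rfl fun j hj => ?_
      rw [if_neg (Finset.ne_of_mem_erase hj), add_comm]
    rw [det_scanMatrix hk, h1]
    change _ * W ^ n = _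
    congr 1
    rw [← Finset.mul_prod_erase _ _ (Finset.mem_univ 0)]
    change (1 + X 0) * Y - X 0 * Y = Y
    ring
  have hdY : pderiv 0 Y = 0 := by
    refine Finset.prod_induction _ (fun g => pderiv (0 : ZMod k) g = 0)
      (fun a b ha hb => by rw [pderiv_mul, ha, hb]; simp) (by simp) fun j hj => ?_
    simp [pderiv_X_of_ne (Finset.ne_of_mem_erase hj)]
  have hdZ : pderiv 0 Z = 0 := by
    refine Finset.prod_induction _ (fun g => pderiv (0 : ZMod k) g = 0)
      (fun a b ha hb => by rw [pderiv_mul, ha, hb]; simp) (by simp) fun j hj => ?_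
    simp [pderiv_X_of_ne (Finset.ne_of_mem_erase hj)]
  have hdW : pderiv 0 W = Y - Z := by
    simp [hW, hdY, hdZ]
  have hmain : C ((n : ℚ) + 1) * (Y * W ^ n) =
      C ((n : ℚ) + 1) * W ^ (n + 1) - X 0 * pderiv 0 (W ^ (n + 1)) := by
    rw [pderiv_pow, hdW]
    conv_rhs => rw [pow_succ]
    simp only [map_add, map_natCast, map_one, Nat.add_sub_cancel, Nat.cast_add, Nat.cast_one]
    rw [show W ^ n * W = W ^ n * ((1 + X 0) * Y - X 0 * Z) by rw [← hW]]
    ring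
  have hcoeffG : coeff q (Y * W ^ n) = ∑ S : Fin (n + 1) → Finset (ZMod k),
      if SprMem k (n + 1) p S then (Matrix.of fun i j : ZMod k =>
        if ∀ h : i ≠ 0, cyc k i j ⊆ S (f ⟨i, h⟩) then (1 : ℚ) else 0).det else 0 := by
    rw [← hG, ← sum_weight_mul_det_scanStep, coeff_sum]
    refine Finset.sum_congr rfl fun S _ => ?_
    rw [det_scanStep_eq_C_det_indicator_cyc hk hf, coeff_prod_X]
  have hcoeffH : coeff q (W ^ (n + 1)) = Mcard k (n + 1) p := by
    have := sum_weight_of_ne_univ (ι := Fin (n + 1)) (X : ZMod k → MvPolynomial (ZMod k) ℚ)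
    rw [Fintype.card_fin] at this
    change _ = W ^ (n + 1) at this
    rw [← this, coeff_sum, Mcard, Nat.card_eq_fintype_card, Fintype.card_subtype,
      Finset.card_filter, Nat.cast_sum]
    refine Finset.sum_congr rfl fun S _ => ?_
    have h1 := coeff_prod_X p S 1
    rw [map_one, mul_one] at h1
    by_cases hS : ∀ t, S t ≠ Finset.univ
    · rw [if_pos hS, h1]
      simp [MprMem, hS]
    · rw [if_neg hS]
      simp [MprMem, hS]
  have hcoeffD : coeff q (X 0 * pderiv 0 (W ^ (n + 1))) = (p 0 : ℚ) * Mcard k (n + 1) p := by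
    rw [coeff_X_mul', ← hcoeffH]
    split_ifs with h
    · have h0 : q 0 ≠ 0 := by simpa using h
      have hq : q - Finsupp.single 0 1 + Finsupp.single 0 1 = q :=
        tsub_add_cancel_of_le (by simpa using Nat.one_le_iff_ne_zero.2 h0)
      rw [coeff_pderiv, hq, mul_comm]
      congr 1
      have : q 0 = p 0 := rfl
      rw [Finsupp.tsub_apply, Finsupp.single_eq_same, ← this]
      push_cast [Nat.one_le_iff_ne_zero.2 h0]
      ring
    · have h0 : p 0 = 0 := by simpa [q] using h
      simp [h0]
  have := congrArg (coeff q) hmain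
  rw [coeff_C_mul, coeff_sub, coeff_C_mul, hcoeffG, hcoeffH, hcoeffD] at this
  push_cast
  rw [this]
  ring

end coefficients

theorem card_OmS (k r : ℕ) [NeZero k] (p : ZMod k → ℕ) :
    Nat.card (OmS k r p) = Scard k r p *
      Nat.card {f : {i : ZMod k // i ≠ 0} → Fin r // Function.Surjective f} := by
  rw [Scard, ← Nat.card_prod]
  exact Nat.card_congr (Equiv.subtypeProdEquivProd (p := SprMem k r p) (q := Function.Surjective))

theorem Pdet_Malpha_eq_sum_div (k r : ℕ) [NeZero k] (p : ZMod k → ℕ) :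
    Pdet (Malpha k r p) = open Classical in
      (∑ f : {f : {i : ZMod k // i ≠ 0} → Fin r // Function.Surjective f},
        ∑ S : Fin r → Finset (ZMod k), if SprMem k r p S then
          (Matrix.of fun i j : ZMod k =>
            if ∀ h : i ≠ 0, cyc k i j ⊆ S (f.1 ⟨i, h⟩) then (1 : ℚ) else 0).det else 0) /
        Nat.card (OmS k r p) := by
  classical
  have h1 : ∀ σ : Equiv.Perm (ZMod k),
      (Nat.card (⋂ i, Malpha k r p i (σ i) : Set (OmS k r p)) : ℚ) =
      ∑ f : {f : {i : ZMod k // i ≠ 0} → Fin r // Function.Surjective f},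
        ∑ S : Fin r → Finset (ZMod k), if SprMem k r p S then
          ∏ i, (if ∀ h : i ≠ 0, cyc k i (σ i) ⊆ S (f.1 ⟨i, h⟩) then (1 : ℚ) else 0) else 0 := by
    intro σ
    have e : (∑ om : OmS k r p, if om ∈ ⋂ i, Malpha k r p i (σ i) then (1 : ℚ) else 0) =
        Nat.card (⋂ i, Malpha k r p i (σ i) : Set (OmS k r p)) := by
      rw [Finset.sum_boole, Nat.card_eq_fintype_card, Fintype.card_subtype]
    rw [← e, ← Fintype.sum_equiv (Equiv.subtypeProdEquivProd (p := SprMem k r p)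
      (q := Function.Surjective)).symm (fun v : {S // SprMem k r p S} ×
        {f : {i : ZMod k // i ≠ 0} → Fin r // Function.Surjective f} =>
        ∏ i, (if ∀ h : i ≠ 0, cyc k i (σ i) ⊆ v.1.1 (v.2.1 ⟨i, h⟩) then (1 : ℚ) else 0)),
      Fintype.sum_prod_type_right]
    · refine Finset.sum_congr rfl fun f _ => ?_
      rw [← Finset.sum_filter, Finset.sum_subtype (p := SprMem k r p) _ (by simp)]
    · rintro ⟨⟨S, hS⟩, f, hf⟩
      simp [Finset.prod_ite_zero, Malpha, Equiv.subtypeProdEquivProd]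
  simp only [Pdet, PrU, h1, mul_div_assoc', ← Finset.sum_div]
  congr 1
  simp only [Finset.mul_sum]
  rw [Finset.sum_comm]
  refine Finset.sum_congr rfl fun f _ => ?_
  rw [Finset.sum_comm]
  refine Finset.sum_congr rfl fun S _ => ?_
  split_ifs
  · rw [← Matrix.det_transpose, Matrix.det_apply']
    simp
  · simp

/-- Proposition 6: `Pdet(M_α) = (|ℳ_{p,r}| / |𝒮_{p,r}|) · (1 - p_k / r)`. -/
theorem Pdet_Malpha (k r : ℕ) [NeZero k] (hr : 0 < r) (hrk : r < k)
    (p : ZMod k → ℕ)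
    (hS : Nonempty {S : Fin r → Finset (ZMod k) // SprMem k r p S}) :
    Pdet (Malpha k r p) =
      ((Mcard k r p : ℚ) / (Scard k r p : ℚ)) * (1 - (p 0 : ℚ) / (r : ℚ)) := by
  classical
  have hk : 1 < k := by omega
  have hr' : (r : ℚ) ≠ 0 := by positivity
  have hS' : (Scard k r p : ℚ) ≠ 0 := by
    have : 0 < Scard k r p := Nat.card_pos
    positivity
  have hF : (Nat.card {f : {i : ZMod k // i ≠ 0} → Fin r // Function.Surjective f} : ℚ) ≠ 0 := by
    have : Nonempty {f : {i : ZMod k // i ≠ 0} → Fin r // Function.Surjective f} := by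
      have : Nonempty (Fin r) := ⟨⟨0, hr⟩⟩
      have hcard : Fintype.card (Fin r) ≤ Fintype.card {i : ZMod k // i ≠ 0} := by
        rw [Fintype.card_fin, Fintype.card_subtype_compl, ZMod.card, Fintype.card_subtype_eq]
        omega
      obtain ⟨g⟩ := Function.Embedding.nonempty_of_card_le hcard
      exact ⟨⟨Function.invFun g, Function.invFun_surjective g.injective⟩⟩
    have : 0 < Nat.card {f : {i : ZMod k // i ≠ 0} → Fin r // Function.Surjective f} :=
      Nat.card_pos
    positivity
  rw [Pdet_Malpha_eq_sum_div, card_OmS, Finset.sum_congr rfl fun f _ =>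
    (eq_div_of_mul_eq hr' ((mul_comm _ _).trans (sum_det_mul hk hr f.2 p)))]
  rw [Finset.sum_const, Finset.card_univ, ← Nat.card_eq_fintype_card, nsmul_eq_mul]
  push_cast
  field_simp
end

section
/- Let k and r be positive integers with r < k and let p = (p_1,…,p_k) be a tuple of non-negative integers. Let D ⊆ [k−1] be a subset containing at least two elements. Then Σ sgn(π) = 0, where the sum is over all triples (S,f,π) with S = (S_1,…,S_r) ∈ S_{p,r}, f a surjection from [k−1] onto [r], and π a permutation of [k−1], satisfying: ]i,k] ⊆ S_{f(i)} for every i∈D, and ]i,π(i)] ⊆ S_{f(i)} for every i∈[k−1]∖D. -/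
open Finset

open scoped Classical in
/-- If `D ⊆ [k-1]` has at least two elements, then the signed count of triples
`(S,f,π)` — with `S ∈ 𝒮_{p,r}`, `f : [k-1] ↠ [r]`, `π` a permutation of `[k-1]` —
satisfying `]i,k] ⊆ S_{f(i)}` for `i ∈ D` and `]i,π(i)] ⊆ S_{f(i)}` for
`i ∈ [k-1] ∖ D`, is zero. -/
theorem signed_sum_bigD (k r : ℕ) [NeZero k] (hr : 0 < r) (hrk : r < k)
    (p : ZMod k → ℕ) (D : Finset {i : ZMod k // i ≠ 0}) (hD : 2 ≤ D.card) :
    ∑ x ∈ Finset.univ.filter (fun x : (Fin r → Finset (ZMod k)) ×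
          ({i : ZMod k // i ≠ 0} → Fin r) × Equiv.Perm {i : ZMod k // i ≠ 0} =>
        SprMem k r p x.1 ∧ Function.Surjective x.2.1 ∧
        (∀ i ∈ D, cyc k i.1 0 ⊆ x.1 (x.2.1 i)) ∧
        (∀ i : {i : ZMod k // i ≠ 0}, i ∉ D → cyc k i.1 (x.2.2 i).1 ⊆ x.1 (x.2.1 i))),
      (Equiv.Perm.sign x.2.2 : ℤ) = 0 := by
  obtain ⟨a, ha, b, hb, hab⟩ := Finset.one_lt_card.mp hD
  refine Finset.sum_involution (fun x _ => (x.1, x.2.1, x.2.2 * Equiv.swap a b)) ?_ ?_ ?_ ?_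
  · intro x _
    simp [Equiv.Perm.sign_mul, Equiv.Perm.sign_swap hab]
  · intro x _ _ hx
    have h : x.2.2 * Equiv.swap a b = x.2.2 := congrArg (fun y => y.2.2) hx
    exact hab (Equiv.swap_eq_one_iff.mp (mul_eq_left.mp h))
  · intro x hx
    obtain ⟨hS, hf, hin, hout⟩ := (Finset.mem_filter.mp hx).2
    refine Finset.mem_filter.mpr ⟨Finset.mem_univ _, hS, hf, hin, fun i hi => ?_⟩
    have hia : i ≠ a := fun h => hi (h ▸ ha)
    have hib : i ≠ b := fun h => hi (h ▸ hb)
    simpa [Equiv.Perm.mul_apply, Equiv.swap_apply_of_ne_of_ne hia hib] using hout i hi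
  · intro x _
    simp [mul_assoc]
end

section
/- Let k ≥ 3 and r be positive integers with r < k, let p = (p_1,…,p_k) be a tuple of non-negative integers, let a ∈ {2,3,…,k−1} and D ⊆ [a−2]. Define subsets K_{i,j} of [k] by: K_{i,i} = ∅ if i∈[a−2]∖D, K_{i,i} = [k] if i∈D∪{a−1}, and K_{i,j} = ]i,j] for i∈{a−1,…,k−1} and j∈[k] with (i,j) ≠ (a−1,a−1). Let 𝔖_{k,a} be the set of permutations π of [k] with π(i) = i for all i∈[a−2]. Then Σ sgn(π) = 0, where the sum is over all triples (S,f,π) with S = (S_1,…,S_r) ∈ S_{p,r}, f a surjection from [k−1] onto [r], and π ∈ 𝔖_{k,a}, satisfying K_{i,π(i)} ⊆ S_{f(i)} for every i∈[k−1]. -/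
open Finset

/-- The sets `K_{i,j}` of Section 5.1 (for given `a ∈ {2,…,k-1}` and `D ⊆ [a-2]`):
`K_{i,i} = ∅` for `i ∈ [a-2] ∖ D`, `K_{i,i} = [k]` for `i ∈ D ∪ {a-1}`, and
`K_{i,j} = ]i,j]` for `i ∈ {a-1,…,k-1}`, `j ∈ [k]`, `(i,j) ≠ (a-1,a-1)`.
(The element `m ∈ [k]` is represented by `(m : ZMod k)`, so `i = a-1` means
`i.val + 1 = a`.) -/
def Kset (k a : ℕ) [NeZero k] (D : Finset (ZMod k)) (i j : ZMod k) : Finset (ZMod k) :=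
  if i = j then (if i.val + 1 = a ∨ i ∈ D then Finset.univ else ∅) else cyc k i j

/-- `H_{f,π,j} = ∪ { K_{i,π(i)} : i ∈ [k-1] ∖ {j}, f(i) = f(j) }`. -/
def Hset (k a r : ℕ) [NeZero k] (D : Finset (ZMod k))
    (f : {i : ZMod k // i ≠ 0} → Fin r) (pi : Equiv.Perm (ZMod k))
    (j : {i : ZMod k // i ≠ 0}) : Finset (ZMod k) :=
  (Finset.univ.filter fun i : {i : ZMod k // i ≠ 0} => i ≠ j ∧ f i = f j).biUnion
    (fun i => Kset k a D i.1 (pi i.1))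

section IntervalSets

variable {k a : ℕ} [NeZero k] {D : Finset (ZMod k)}

lemma zmod_val_sub_cases (x y : ZMod k) :
    (y.val ≤ x.val ∧ (x - y).val = x.val - y.val) ∨
      (x.val < y.val ∧ (x - y).val = x.val + k - y.val) := by
  rcases le_or_gt y.val x.val with h | h
  · exact Or.inl ⟨h, ZMod.val_sub h⟩
  · refine Or.inr ⟨h, ?_⟩
    have hyx : (y - x).val = y.val - x.val := ZMod.val_sub h.le
    have hne : y - x ≠ 0 := by
      intro h0
      rw [h0, ZMod.val_zero] at hyx
      omega
    have hneg := ZMod.neg_val (y - x)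
    rw [neg_sub, if_neg hne, hyx] at hneg
    have := ZMod.val_lt y
    omega

lemma mem_cyc_iff (i j x : ZMod k) :
    x ∈ cyc k i j ↔
      (i.val < x.val ∧ x.val ≤ j.val) ∨ (j.val < i.val ∧ i.val < x.val) ∨
        (j.val < i.val ∧ x.val ≤ j.val) := by
  have := ZMod.val_lt x
  have := ZMod.val_lt i
  have := ZMod.val_lt j
  rw [cyc, Finset.mem_filter]
  simp only [Finset.mem_univ, true_and]
  rcases zmod_val_sub_cases x i with h | h <;> rcases zmod_val_sub_cases j i with h' | h' <;> omega

lemma zmod_eq_iff_val_eq (x y : ZMod k) : x = y ↔ x.val = y.val :=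
  (ZMod.val_injective k).eq_iff.symm

/-- For `i ≥ a`, the set `K_{i,j}` is the interval `]i,j]`. -/
lemma Kset_of_le (hD : ∀ i ∈ D, 1 ≤ i.val ∧ i.val ≤ a - 2) {i : ZMod k} (hi : a ≤ i.val)
    (j : ZMod k) : Kset k a D i j = cyc k i j := by
  unfold Kset
  split_ifs with h h'
  · rcases h' with h' | h'
    · omega
    · have := hD i h'
      omega
  · subst h
    ext x
    rw [mem_cyc_iff]
    simp only [Finset.notMem_empty, false_iff]
    omega
  · rfl

/-- The sets of row `a - 1` are those of row `a` with the element `a` added. -/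
lemma Kset_pred (hD : ∀ i ∈ D, 1 ≤ i.val ∧ i.val ≤ a - 2) {u v : ZMod k} (hu : u.val = a)
    (hv : v.val + 1 = a) (j : ZMod k) : Kset k a D v j = insert u (Kset k a D u j) := by
  rw [Kset_of_le hD hu.ge]
  ext x
  rw [Finset.mem_insert, mem_cyc_iff, zmod_eq_iff_val_eq x u]
  unfold Kset
  have := ZMod.val_lt x
  have := ZMod.val_lt j
  split_ifs with h h'
  · subst h
    simp only [Finset.mem_univ, true_iff]
    omega
  · exact absurd (Or.inl hv) h'
  · rw [zmod_eq_iff_val_eq] at h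
    rw [mem_cyc_iff]
    omega

end IntervalSets

section RowIndicators

/-- The `0/1` entry recording that `K_{i,j} ⊆ X`, where the rows `i ∈ [a-2]` are allowed only
their diagonal entry. -/
noncomputable def rowInd (k a : ℕ) [NeZero k] (D X : Finset (ZMod k)) (i j : ZMod k) : ℤ :=
  open scoped Classical in
  if (1 ≤ i.val → i.val ≤ a - 2 → j = i) ∧ Kset k a D i j ⊆ X then 1 else 0

variable {k a : ℕ} [NeZero k] {D X : Finset (ZMod k)} {u v : ZMod k}

lemma rowInd_of_lt {i : ZMod k} (hi : a - 2 < i.val) (X : Finset (ZMod k)) (j : ZMod k) :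
    rowInd k a D X i j = if Kset k a D i j ⊆ X then 1 else 0 := by
  have hlow : 1 ≤ i.val → i.val ≤ a - 2 → j = i := by omega
  rw [rowInd, if_congr (and_iff_right hlow) rfl rfl]

lemma rowInd_at (ha : 2 ≤ a) (hD : ∀ i ∈ D, 1 ≤ i.val ∧ i.val ≤ a - 2) (hu : u.val = a)
    (X : Finset (ZMod k)) (j : ZMod k) :
    rowInd k a D X u j = if cyc k u j ⊆ X then 1 else 0 := by
  rw [rowInd_of_lt (by omega), Kset_of_le hD hu.ge]

lemma rowInd_pred (ha : 2 ≤ a) (hD : ∀ i ∈ D, 1 ≤ i.val ∧ i.val ≤ a - 2) (hu : u.val = a)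
    (hv : v.val + 1 = a) (X : Finset (ZMod k)) (j : ZMod k) :
    rowInd k a D X v j = if u ∈ X then rowInd k a D X u j else 0 := by
  rw [rowInd_at ha hD hu, rowInd_of_lt (by omega), Kset_pred hD hu hv, Kset_of_le hD hu.ge,
    if_congr Finset.insert_subset_iff rfl rfl, ite_and]

lemma rowInd_at_congr (ha : 2 ≤ a) (hD : ∀ i ∈ D, 1 ≤ i.val ∧ i.val ≤ a - 2) (hu : u.val = a)
    {X Y : Finset (ZMod k)} (hXY : ∀ x, x ≠ u → (x ∈ X ↔ x ∈ Y)) :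
    rowInd k a D X u = rowInd k a D Y u := by
  funext j
  rw [rowInd_at ha hD hu, rowInd_at ha hD hu]
  congr 1
  have hne : ∀ x ∈ cyc k u j, x ≠ u := by
    rintro x hx rfl
    rw [mem_cyc_iff] at hx
    omega
  exact propext ⟨fun h x hx => (hXY x (hne x hx)).1 (h hx),
    fun h x hx => (hXY x (hne x hx)).2 (h hx)⟩

lemma rowInd_at_eq_one (ha : 2 ≤ a) (hD : ∀ i ∈ D, 1 ≤ i.val ∧ i.val ≤ a - 2) (hu : u.val = a)
    (hX : ∀ x, x ≠ u → x ∈ X) (j : ZMod k) : rowInd k a D X u j = 1 := by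
  have h := congrFun (rowInd_at_congr ha hD hu (X := X) (Y := Finset.univ) (by simpa using hX)) j
  rw [h, rowInd_at ha hD hu, if_pos (Finset.subset_univ _)]

/-- Removing `a` from a proper subset changes every row outside `{a-1, k}` by a multiple
of row `a`. -/
lemma exists_rowInd_eq_erase_add (ha : 2 ≤ a) (hD : ∀ i ∈ D, 1 ≤ i.val ∧ i.val ≤ a - 2)
    (hu : u.val = a) (huX : u ∈ X) (hX : X ≠ Finset.univ) {i : ZMod k} (hi0 : i ≠ 0)
    (hi : i.val + 1 ≠ a) :
    ∃ c : ℤ, ∀ j, rowInd k a D X i j = rowInd k a D (X.erase u) i j + c * rowInd k a D X u j := by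
  classical
  have hi0' : i.val ≠ 0 := by rwa [Ne, ZMod.val_eq_zero]
  rcases lt_trichotomy i.val a with hlt | heq | hgt
  · refine ⟨0, fun j => ?_⟩
    rw [zero_mul, add_zero]
    unfold rowInd
    congr 1
    refine propext (and_congr_right fun hlow => ?_)
    obtain rfl := hlow (by omega) (by omega)
    unfold Kset
    split_ifs with h h'
    · rw [Finset.univ_subset_iff, Finset.univ_subset_iff]
      refine iff_of_false hX fun h => ?_
      exact Finset.notMem_erase u X (h ▸ Finset.mem_univ u)
    · simp
    · exact absurd rfl h
  · obtain rfl : i = u := (zmod_eq_iff_val_eq i u).2 (heq.trans hu.symm)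
    refine ⟨0, fun j => ?_⟩
    rw [zero_mul, add_zero]
    exact congrFun (rowInd_at_congr ha hD hu fun x hx => by simp [hx]) j
  · refine ⟨if cyc k i u ⊆ X then 1 else 0, fun j => ?_⟩
    rw [rowInd_at ha hD hu, rowInd_of_lt (by omega), rowInd_of_lt (by omega), Kset_of_le hD hgt.le]
    by_cases hj : u ∈ cyc k i j
    · have hunion : cyc k i j = cyc k i u ∪ cyc k u j := by
        ext x
        rw [mem_cyc_iff] at hj
        rw [Finset.mem_union, mem_cyc_iff, mem_cyc_iff, mem_cyc_iff]
        have := ZMod.val_lt x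
        omega
      have herase : ¬ cyc k i j ⊆ X.erase u := fun h => Finset.notMem_erase u X (h hj)
      rw [if_neg herase, hunion, if_congr Finset.union_subset_iff rfl rfl]
      by_cases h1 : cyc k i u ⊆ X <;> by_cases h2 : cyc k u j ⊆ X <;> simp [h1, h2]
    · have herase : cyc k i j ⊆ X.erase u ↔ cyc k i j ⊆ X := by
        rw [Finset.subset_erase]
        simp [hj]
      have hnot : ¬ (cyc k i u ⊆ X ∧ cyc k u j ⊆ X) := by
        rintro ⟨h1, h2⟩
        refine hX (Finset.eq_univ_iff_forall.2 fun x => ?_)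
        by_cases hx : x ∈ cyc k i u
        · exact h1 hx
        · refine h2 ?_
          rw [mem_cyc_iff] at hj hx ⊢
          have := ZMod.val_lt x
          omega
      rw [if_congr herase rfl rfl]
      by_cases h1 : cyc k i u ⊆ X <;> by_cases h2 : cyc k u j ⊆ X <;> simp_all

end RowIndicators

section Determinants

lemma det_updateRow_finset_sum {n ι R : Type*} [Fintype n] [DecidableEq n] [CommRing R]
    (M : Matrix n n R) (i : n) (t : Finset ι) (g : ι → n → R) :
    (M.updateRow i (∑ m ∈ t, g m)).det = ∑ m ∈ t, (M.updateRow i (g m)).det :=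
  (Matrix.detRowAlternating : (n → R) [⋀^n]→ₗ[R] R).map_update_sum t i g M

/-- If outside rows `i₁ ≠ i₂` the matrices differ by combinations of the rows `x`, `y`, then
exchanging the rows `x`, `y` placed at `i₁`, `i₂` changes the sign of the determinant. -/
lemma det_updateRow_swap_of_combination {n R : Type*} [Fintype n] [DecidableEq n] [CommRing R]
    {M N : Matrix n n R} {i₁ i₂ : n} (hne : i₁ ≠ i₂) (x y : n → R)
    (h : ∀ i, i ≠ i₁ → i ≠ i₂ → ∃ c d : R, ∀ j, M i j = N i j + c * x j + d * y j) :
    ((M.updateRow i₁ x).updateRow i₂ y).det = -((N.updateRow i₁ y).updateRow i₂ x).det := by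
  have h' : ∀ i, ∃ c d : R, i ≠ i₁ → i ≠ i₂ → ∀ j, M i j = N i j + c * x j + d * y j := by
    intro i
    by_cases h1 : i = i₁
    · exact ⟨0, 0, fun h => absurd h1 h⟩
    by_cases h2 : i = i₂
    · exact ⟨0, 0, fun _ h => absurd h2 h⟩
    obtain ⟨c, d, hcd⟩ := h i h1 h2
    exact ⟨c, d, fun _ _ => hcd⟩
  choose c d hcd using h'
  have hswap : ((N.updateRow i₁ y).updateRow i₂ x).det =
      -((N.updateRow i₁ x).updateRow i₂ y).det := by
    have hperm := Matrix.det_permute (Equiv.swap i₁ i₂) ((N.updateRow i₁ x).updateRow i₂ y)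
    rw [Equiv.Perm.sign_swap hne] at hperm
    simp only [Units.val_neg, Units.val_one, Int.cast_neg, Int.cast_one, neg_mul, one_mul] at hperm
    rw [← hperm]
    congr 1
    ext i j
    rw [Matrix.submatrix_apply, id]
    by_cases h1 : i = i₁
    · subst h1
      simp [Matrix.updateRow_apply, hne]
    by_cases h2 : i = i₂
    · subst h2
      simp [Matrix.updateRow_apply, hne]
    · simp [Matrix.updateRow_apply, Equiv.swap_apply_of_ne_of_ne h1 h2, h1, h2]
  rw [hswap, neg_neg]
  let P : Matrix n n R := Matrix.of fun i j =>
    if i = i₁ then x j else if i = i₂ then y j else N i j + c i * x j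
  have hMP : ((M.updateRow i₁ x).updateRow i₂ y).det = P.det := by
    refine Matrix.det_eq_of_forall_row_eq_smul_add_const
      (fun i => if i = i₁ ∨ i = i₂ then 0 else d i) i₂ (by simp) fun i j => ?_
    by_cases h1 : i = i₁
    · simp [P, Matrix.updateRow_apply, h1, hne]
    by_cases h2 : i = i₂
    · simp [P, Matrix.updateRow_apply, h2, hne.symm]
    · simp [P, Matrix.updateRow_apply, h1, h2, hne.symm, hcd i h1 h2 j]
  have hPN : P.det = ((N.updateRow i₁ x).updateRow i₂ y).det := by
    refine Matrix.det_eq_of_forall_row_eq_smul_add_const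
      (fun i => if i = i₁ ∨ i = i₂ then 0 else c i) i₁ (by simp) fun i j => ?_
    by_cases h1 : i = i₁
    · simp [P, Matrix.updateRow_apply, h1, hne]
    by_cases h2 : i = i₂
    · simp [P, Matrix.updateRow_apply, h2, hne.symm]
    · simp [P, Matrix.updateRow_apply, h1, h2, hne]
  rw [hMP, hPN]

end Determinants

section MoveElement

/-- The tuple obtained from `S` by moving the element `u` from `S m` to `S n`. -/
def moveElem {k r : ℕ} (u : ZMod k) (S : Fin r → Finset (ZMod k)) (m n : Fin r) :
    Fin r → Finset (ZMod k) :=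
  Function.update (Function.update S m ((S m).erase u)) n (insert u (S n))

variable {k r : ℕ} {u : ZMod k} {S : Fin r → Finset (ZMod k)} {m n : Fin r}

lemma moveElem_left (hmn : m ≠ n) : moveElem u S m n m = (S m).erase u := by
  simp [moveElem, hmn]

lemma moveElem_right : moveElem u S m n n = insert u (S n) := by
  simp [moveElem]

lemma moveElem_of_ne {l : Fin r} (hm : l ≠ m) (hn : l ≠ n) : moveElem u S m n l = S l := by
  simp [moveElem, hm, hn]

lemma moveElem_moveElem (hm : u ∈ S m) (hn : u ∉ S n) :
    moveElem u (moveElem u S m n) n m = S := by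
  have hmn : m ≠ n := fun h => hn (h ▸ hm)
  funext l
  by_cases h1 : l = m
  · subst h1
    rw [moveElem_right, moveElem_left hmn, Finset.insert_erase hm]
  by_cases h2 : l = n
  · subst h2
    rw [moveElem_left hmn.symm, moveElem_right, Finset.erase_insert hn]
  · rw [moveElem_of_ne h2 h1, moveElem_of_ne h1 h2]

end MoveElement

section CountMatrix

/-- The matrix whose entry `(i,j)`, for `i ≠ k`, counts the `l ∈ R` with `K_{i,j} ⊆ S_l`
(off-diagonal entries of the rows in `[a-2]` being zero), and whose row `k` is constant `1`. -/
noncomputable def countMatrix (k a : ℕ) [NeZero k] (D : Finset (ZMod k)) {r : ℕ}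
    (R : Finset (Fin r)) (S : Fin r → Finset (ZMod k)) : Matrix (ZMod k) (ZMod k) ℤ :=
  Matrix.of fun i j => if i = 0 then 1 else ∑ l ∈ R, rowInd k a D (S l) i j

/-- The summand of the expansion of `det (countMatrix k a D R S)` in which row `v` comes from the
set `S m` and row `u` from the set `S n`. -/
noncomputable def pairDet (k a : ℕ) [NeZero k] (D : Finset (ZMod k)) {r : ℕ} (u v : ZMod k)
    (R : Finset (Fin r)) (S : Fin r → Finset (ZMod k)) (m n : Fin r) : ℤ :=
  (((countMatrix k a D R S).updateRow v (rowInd k a D (S m) u)).updateRow u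
    (rowInd k a D (S n) u)).det

variable {k a r : ℕ} [NeZero k] {D : Finset (ZMod k)} {u v : ZMod k}
  {S : Fin r → Finset (ZMod k)} {R : Finset (Fin r)} {m n : Fin r}

lemma sprMem_moveElem {p : ZMod k → ℕ} (hS : SprMem k r p S) (hm : u ∈ S m) (hn : u ∉ S n) :
    SprMem k r p (moveElem u S m n) := by
  have hmn : m ≠ n := fun h => hn (h ▸ hm)
  intro j
  rw [← hS j]
  by_cases hj : j = u
  · subst hj
    refine Nat.card_congr ((Equiv.swap m n).subtypeEquiv fun l => ?_)
    by_cases h1 : l = m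
    · subst h1
      simp [moveElem_left hmn, hn]
    by_cases h2 : l = n
    · subst h2
      simp [moveElem_right, hm]
    · rw [Equiv.swap_apply_of_ne_of_ne h1 h2, moveElem_of_ne h1 h2]
  · refine Nat.card_congr (Equiv.subtypeEquivRight fun l => ?_)
    by_cases h2 : l = n
    · subst h2
      simp [moveElem_right, hj]
    by_cases h1 : l = m
    · subst h1
      simp [moveElem_left hmn, hj]
    · rw [moveElem_of_ne h1 h2]

lemma pairDet_eq_zero_left (hu0 : u ≠ 0) (hv0 : v ≠ 0) (huv : u ≠ v)
    (h : ∀ j, rowInd k a D (S m) u j = 1) : pairDet k a D u v R S m n = 0 := by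
  refine Matrix.det_zero_of_row_eq hv0 (funext fun j => ?_)
  simp [Matrix.updateRow_apply, huv.symm, hu0.symm, hv0.symm, countMatrix, h]

lemma pairDet_eq_zero_right (hu0 : u ≠ 0) (hv0 : v ≠ 0)
    (h : ∀ j, rowInd k a D (S n) u j = 1) : pairDet k a D u v R S m n = 0 := by
  refine Matrix.det_zero_of_row_eq hu0 (funext fun j => ?_)
  simp [Matrix.updateRow_apply, hu0.symm, hv0.symm, countMatrix, h]

/-- Moving the element `a` from `S m` to `S n` negates the corresponding summand. -/
lemma pairDet_moveElem (ha : 2 ≤ a) (hD : ∀ i ∈ D, 1 ≤ i.val ∧ i.val ≤ a - 2)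
    (hu : u.val = a) (hv : v.val + 1 = a) (hmR : m ∈ R) (hnR : n ∈ R)
    (hm : u ∈ S m) (hn : u ∉ S n) :
    pairDet k a D u v R (moveElem u S m n) n m = -pairDet k a D u v R S m n := by
  have hmn : m ≠ n := fun h => hn (h ▸ hm)
  have hu0 : u ≠ 0 := by
    rintro rfl
    rw [ZMod.val_zero] at hu
    omega
  have hv0 : v ≠ 0 := by
    rintro rfl
    rw [ZMod.val_zero] at hv
    omega
  have huv : u ≠ v := by
    rintro rfl
    omega
  have hrowm : rowInd k a D (moveElem u S m n m) u = rowInd k a D (S m) u := by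
    rw [moveElem_left hmn]
    exact rowInd_at_congr ha hD hu fun x hx => by simp [hx]
  have hrown : rowInd k a D (moveElem u S m n n) u = rowInd k a D (S n) u := by
    rw [moveElem_right]
    exact rowInd_at_congr ha hD hu fun x hx => by simp [hx]
  by_cases hfull : S m = Finset.univ
  · have h1 : ∀ j, rowInd k a D (S m) u j = 1 :=
      rowInd_at_eq_one ha hD hu fun x _ => hfull ▸ Finset.mem_univ x
    rw [pairDet_eq_zero_left hu0 hv0 huv h1, pairDet_eq_zero_right hu0 hv0 (hrowm ▸ h1), neg_zero]
  by_cases hfull' : insert u (S n) = Finset.univ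
  · have h1 : ∀ j, rowInd k a D (S n) u j = 1 :=
      rowInd_at_eq_one ha hD hu fun x hx =>
        Finset.mem_of_mem_insert_of_ne (hfull' ▸ Finset.mem_univ x) hx
    rw [pairDet_eq_zero_right hu0 hv0 h1, pairDet_eq_zero_left hu0 hv0 huv (hrown ▸ h1), neg_zero]
  unfold pairDet
  rw [hrowm, hrown]
  refine det_updateRow_swap_of_combination huv.symm _ _ fun i hiv hiu => ?_
  by_cases hi0 : i = 0
  · exact ⟨0, 0, fun j => by simp [countMatrix, hi0]⟩
  have hi : i.val + 1 ≠ a := fun h => hiv ((zmod_eq_iff_val_eq i v).2 (by omega))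
  obtain ⟨c, hc⟩ := exists_rowInd_eq_erase_add ha hD hu hm hfull hi0 hi
  obtain ⟨d, hd⟩ :=
    exists_rowInd_eq_erase_add ha hD hu (Finset.mem_insert_self u (S n)) hfull' hi0 hi
  refine ⟨d, -c, fun j => ?_⟩
  have hnm : n ∈ R.erase m := Finset.mem_erase.2 ⟨hmn.symm, hnR⟩
  have hsplit : ∀ g : Fin r → ℤ, ∑ l ∈ R, g l = g m + (g n + ∑ l ∈ (R.erase m).erase n, g l) :=
    fun g => by rw [Finset.add_sum_erase _ g hnm, Finset.add_sum_erase _ g hmR]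
  have hrest : ∑ l ∈ (R.erase m).erase n, rowInd k a D (moveElem u S m n l) i j =
      ∑ l ∈ (R.erase m).erase n, rowInd k a D (S l) i j := by
    refine Finset.sum_congr rfl fun l hl => ?_
    rw [Finset.mem_erase, Finset.mem_erase] at hl
    rw [moveElem_of_ne hl.2.1 hl.1]
  have hcj := hc j
  have hdj := hd j
  rw [Finset.erase_insert hn, ← moveElem_right (S := S) (m := m), congrFun hrown j] at hdj
  rw [← moveElem_left hmn] at hcj
  simp only [countMatrix, Matrix.of_apply, if_neg hi0]
  rw [hsplit, hsplit fun l => rowInd k a D (S l) i j, hrest, hcj, hdj]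
  ring

lemma det_countMatrix (ha : 2 ≤ a) (hD : ∀ i ∈ D, 1 ≤ i.val ∧ i.val ≤ a - 2)
    (hu : u.val = a) (hv : v.val + 1 = a) (R : Finset (Fin r)) (S : Fin r → Finset (ZMod k)) :
    (countMatrix k a D R S).det =
      ∑ m ∈ R with u ∈ S m, ∑ n ∈ R with u ∉ S n, pairDet k a D u v R S m n := by
  have hu0 : u ≠ 0 := by
    rintro rfl
    rw [ZMod.val_zero] at hu
    omega
  have hv0 : v ≠ 0 := by
    rintro rfl
    rw [ZMod.val_zero] at hv
    omega
  have huv : u ≠ v := by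
    rintro rfl
    omega
  set A := countMatrix k a D R S with hA
  set x : ZMod k → ℤ := ∑ m ∈ R with u ∈ S m, rowInd k a D (S m) u with hx
  set y : ZMod k → ℤ := ∑ n ∈ R with u ∉ S n, rowInd k a D (S n) u with hy
  have hAv : A v = x := by
    funext j
    rw [hx, Finset.sum_apply, Finset.sum_filter]
    simp only [hA, countMatrix, Matrix.of_apply, if_neg hv0, rowInd_pred ha hD hu hv]
  have hAu : A u = x + y := by
    rw [hx, hy, Finset.sum_filter_add_sum_filter_not]
    funext j
    simp only [hA, countMatrix, Matrix.of_apply, if_neg hu0, Finset.sum_apply]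
  have hself : A = (A.updateRow v x).updateRow u (x + y) := by
    rw [← hAu, ← hAv, Matrix.updateRow_eq_self, Matrix.updateRow_eq_self]
  have hzero : ((A.updateRow v x).updateRow u x).det = 0 := by
    refine Matrix.det_zero_of_row_eq huv (funext fun j => ?_)
    simp [Matrix.updateRow_apply, huv.symm]
  rw [hself, Matrix.det_updateRow_add, hzero, zero_add, hy, det_updateRow_finset_sum,
    Finset.sum_comm]
  refine Finset.sum_congr rfl fun n _ => ?_
  rw [Matrix.updateRow_comm _ huv.symm, hx, det_updateRow_finset_sum]
  refine Finset.sum_congr rfl fun m _ => ?_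
  rw [Matrix.updateRow_comm _ huv, pairDet]

open scoped Classical in
/-- The determinants of the count matrices cancel when summed over `𝒮_{p,r}`. -/
lemma sum_det_countMatrix (ha : 2 ≤ a) (hak : a < k)
    (hD : ∀ i ∈ D, 1 ≤ i.val ∧ i.val ≤ a - 2) (p : ZMod k → ℕ) (R : Finset (Fin r)) :
    ∑ S : Fin r → Finset (ZMod k) with SprMem k r p S, (countMatrix k a D R S).det = 0 := by
  obtain ⟨u, hu⟩ : ∃ u : ZMod k, u.val = a := ⟨a, ZMod.val_cast_of_lt hak⟩
  obtain ⟨v, hv⟩ : ∃ v : ZMod k, v.val + 1 = a :=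
    ⟨(a - 1 : ℕ), by rw [ZMod.val_cast_of_lt (by omega)]; omega⟩
  have hexpand : ∑ S : Fin r → Finset (ZMod k) with SprMem k r p S, (countMatrix k a D R S).det =
      ∑ t : (Fin r → Finset (ZMod k)) × Fin r × Fin r with
        SprMem k r p t.1 ∧ (t.2.1 ∈ R ∧ u ∈ t.1 t.2.1) ∧ (t.2.2 ∈ R ∧ u ∉ t.1 t.2.2),
        pairDet k a D u v R t.1 t.2.1 t.2.2 := by
    simp only [det_countMatrix ha hD hu hv]
    rw [Finset.sum_filter, Finset.sum_filter, Fintype.sum_prod_type]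
    refine Finset.sum_congr rfl fun S _ => ?_
    rw [Fintype.sum_prod_type]
    by_cases hS : SprMem k r p S
    · rw [if_pos hS, ← Finset.filter_univ_mem R, Finset.filter_filter, Finset.filter_filter,
        Finset.sum_filter]
      refine Finset.sum_congr rfl fun m _ => ?_
      rw [Finset.sum_filter]
      by_cases hm : m ∈ R ∧ u ∈ S m <;> simp [hS, hm]
    · simp [hS]
  rw [hexpand]
  refine Finset.sum_involution (fun t _ => (moveElem u t.1 t.2.1 t.2.2, t.2.2, t.2.1))
    ?_ ?_ ?_ ?_
  · rintro ⟨S, m, n⟩ ht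
    obtain ⟨-, ⟨hmR, hm⟩, hnR, hn⟩ := (Finset.mem_filter.1 ht).2
    dsimp only at hmR hm hnR hn ⊢
    rw [pairDet_moveElem ha hD hu hv hmR hnR hm hn, add_neg_cancel]
  · rintro ⟨S, m, n⟩ ht - heq
    obtain ⟨-, ⟨-, hm⟩, -, hn⟩ := (Finset.mem_filter.1 ht).2
    rw [Prod.mk.injEq, Prod.mk.injEq] at heq
    exact hn (heq.2.2 ▸ hm)
  · rintro ⟨S, m, n⟩ ht
    obtain ⟨hS, ⟨hmR, hm⟩, hnR, hn⟩ := (Finset.mem_filter.1 ht).2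
    dsimp only at hS hmR hm hnR hn ⊢
    have hmn : m ≠ n := fun h => hn (h ▸ hm)
    refine Finset.mem_filter.2 ⟨Finset.mem_univ _, sprMem_moveElem hS hm hn, ⟨hnR, ?_⟩, hmR, ?_⟩
    · dsimp only
      rw [moveElem_right]
      exact Finset.mem_insert_self u _
    · dsimp only
      rw [moveElem_left hmn]
      exact Finset.notMem_erase u _
  · rintro ⟨S, m, n⟩ ht
    obtain ⟨-, ⟨-, hm⟩, -, hn⟩ := (Finset.mem_filter.1 ht).2
    simp only [moveElem_moveElem hm hn]

end CountMatrix

section Surjections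

/-- Inclusion–exclusion for the indicator of surjectivity. -/
lemma ite_surjective_eq_sum {ι κ : Type*} [Fintype ι] [Fintype κ] [DecidableEq κ] (f : ι → κ)
    [Decidable (Function.Surjective f)] :
    (if Function.Surjective f then 1 else 0 : ℤ) =
      ∑ R : Finset κ, (-1) ^ #Rᶜ * if ∀ i, f i ∈ R then 1 else 0 := by
  have hfactor : ∀ m : κ, (if ∃ i, f i = m then 1 else 0 : ℤ) =
      1 + -(if ∀ i, f i ≠ m then 1 else 0) := by
    intro m
    by_cases h : ∃ i, f i = m
    · rw [if_pos h, if_neg (by simpa using h)]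
      norm_num
    · rw [if_neg h, if_pos (by simpa using h)]
      norm_num
  have hprod : (if Function.Surjective f then 1 else 0 : ℤ) =
      ∏ m : κ, if ∃ i, f i = m then 1 else 0 := by
    rw [Fintype.prod_boole]
    exact if_congr Iff.rfl rfl rfl
  rw [hprod, Finset.prod_congr rfl fun m _ => hfactor m, Fintype.prod_add]
  refine Finset.sum_congr rfl fun R _ => ?_
  rw [Finset.prod_const_one, one_mul, Finset.prod_neg, Finset.prod_boole]
  congr 1
  by_cases h : ∀ i, f i ∈ R
  · rw [if_pos h, if_pos fun m hm i hi => Finset.mem_compl.1 hm (hi ▸ h i)]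
  · rw [if_neg h, if_neg fun h' => h fun i => ?_]
    by_contra hi
    exact h' (f i) (Finset.mem_compl.2 hi) i rfl

lemma sum_surjective_mul {ι κ : Type*} [Fintype ι] [DecidableEq ι] [Fintype κ] [DecidableEq κ]
    [DecidablePred fun f : ι → κ => Function.Surjective f] (g : (ι → κ) → ℤ) :
    ∑ f : ι → κ, (if Function.Surjective f then 1 else 0) * g f =
      ∑ R : Finset κ, (-1) ^ #Rᶜ * ∑ f : ι → κ with ∀ i, f i ∈ R, g f := by
  simp only [Finset.sum_filter, Finset.mul_sum]
  rw [Finset.sum_comm]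
  refine Finset.sum_congr rfl fun f _ => ?_
  rw [ite_surjective_eq_sum, Finset.sum_mul]
  refine Finset.sum_congr rfl fun R _ => ?_
  by_cases h : ∀ i, f i ∈ R <;> simp [h]

variable {k a r : ℕ} [NeZero k] {D : Finset (ZMod k)}

/-- Summing over all maps into `R` turns the signed count into a determinant. -/
lemma sum_maps_eq_det (R : Finset (Fin r)) (S : Fin r → Finset (ZMod k)) :
    ∑ f : {i : ZMod k // i ≠ 0} → Fin r with ∀ i, f i ∈ R, ∑ π : Equiv.Perm (ZMod k),
        (Equiv.Perm.sign π : ℤ) * ∏ i : {i : ZMod k // i ≠ 0}, rowInd k a D (S (f i)) i (π i) =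
      (countMatrix k a D R S).det := by
  rw [← Matrix.det_transpose, Matrix.det_apply', Finset.sum_comm]
  refine Finset.sum_congr rfl fun π _ => ?_
  rw [← Finset.mul_sum]
  congr 1
  have hpi : (Finset.univ.filter fun f : {i : ZMod k // i ≠ 0} → Fin r => ∀ i, f i ∈ R) =
      Fintype.piFinset fun _ => R := by
    ext f
    simp
  rw [hpi, ← Finset.prod_univ_sum (fun _ => R)
      fun (i : {i : ZMod k // i ≠ 0}) l => rowInd k a D (S l) i.1 (π i.1),
    Fintype.prod_eq_mul_prod_subtype_ne _ (0 : ZMod k)]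
  simp only [Matrix.transpose_apply, countMatrix, Matrix.of_apply, if_true, one_mul]
  exact Finset.prod_congr rfl fun i _ => (if_neg i.2).symm

end Surjections

open scoped Classical in
/-- Lemma 8 (`Pdet(N^{a,D}) = 0`): the signed count of triples `(S,f,π)` — with
`S ∈ 𝒮_{p,r}`, `f : [k-1] ↠ [r]`, `π ∈ 𝔖_{k,a}` (permutations of `[k]` fixing
`[a-2]` pointwise) — satisfying `K_{i,π(i)} ⊆ S_{f(i)}` for every `i ∈ [k-1]`,
is zero. -/
theorem signed_sum_NaD (k r : ℕ) [NeZero k] (hk : 3 ≤ k) (hr : 0 < r) (hrk : r < k)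
    (p : ZMod k → ℕ) (a : ℕ) (ha : 2 ≤ a) (hak : a ≤ k - 1)
    (D : Finset (ZMod k)) (hD : ∀ i ∈ D, 1 ≤ i.val ∧ i.val ≤ a - 2) :
    ∑ x ∈ Finset.univ.filter (fun x : (Fin r → Finset (ZMod k)) ×
          ({i : ZMod k // i ≠ 0} → Fin r) × Equiv.Perm (ZMod k) =>
        SprMem k r p x.1 ∧ Function.Surjective x.2.1 ∧
        (∀ i : ZMod k, 1 ≤ i.val → i.val ≤ a - 2 → x.2.2 i = i) ∧
        (∀ i : {i : ZMod k // i ≠ 0}, Kset k a D i.1 (x.2.2 i.1) ⊆ x.1 (x.2.1 i))),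
      (Equiv.Perm.sign x.2.2 : ℤ) = 0 := by
  have hrow : ∀ (S : Fin r → Finset (ZMod k)) (f : {i : ZMod k // i ≠ 0} → Fin r)
      (π : Equiv.Perm (ZMod k)),
      ∏ i : {i : ZMod k // i ≠ 0}, rowInd k a D (S (f i)) i (π i) =
        if (∀ i : ZMod k, 1 ≤ i.val → i.val ≤ a - 2 → π i = i) ∧
          (∀ i : {i : ZMod k // i ≠ 0}, Kset k a D i.1 (π i.1) ⊆ S (f i)) then 1 else 0 := by
    intro S f π
    simp only [rowInd, Fintype.prod_boole]
    congr 1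
    rw [forall_and]
    refine propext (and_congr_left fun _ => ⟨fun h i hi => h ⟨i, ?_⟩ hi, fun h i => h i⟩)
    rintro rfl
    simp at hi
  calc _ = ∑ S : Fin r → Finset (ZMod k) with SprMem k r p S,
        ∑ f : {i : ZMod k // i ≠ 0} → Fin r, (if Function.Surjective f then 1 else 0) *
          ∑ π : Equiv.Perm (ZMod k), (Equiv.Perm.sign π : ℤ) *
            ∏ i : {i : ZMod k // i ≠ 0}, rowInd k a D (S (f i)) i (π i) := by
        rw [Finset.sum_filter, Fintype.sum_prod_type, Finset.sum_filter]
        refine Finset.sum_congr rfl fun S _ => ?_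
        rw [Fintype.sum_prod_type]
        by_cases hS : SprMem k r p S
        · rw [if_pos hS]
          refine Finset.sum_congr rfl fun f _ => ?_
          rw [Finset.mul_sum]
          refine Finset.sum_congr rfl fun π _ => ?_
          rw [hrow]
          by_cases hf : Function.Surjective f <;> simp [hS, hf]
        · simp [hS]
    _ = ∑ R : Finset (Fin r), (-1) ^ #Rᶜ *
        ∑ S : Fin r → Finset (ZMod k) with SprMem k r p S, (countMatrix k a D R S).det := by
        simp only [sum_surjective_mul, sum_maps_eq_det]
        rw [Finset.sum_comm]
        simp only [Finset.mul_sum]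
    _ = 0 := by
        simp only [sum_det_countMatrix ha (show a < k by omega) hD p, mul_zero,
          Finset.sum_const_zero]
end
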